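/- In the symmetric group on the 16 points {0,1,…,15}, let τ₁ = (1,4,2,7)(5,6)(8,13,11,14)(12,15) and τ₂ = (1,6)(2,14)(3,8)(4,15)(5,9)(10,13). Then the subgroup of Sym(16) generated by τ₁ and τ₂ is isomorphic to the alternating group A₈. -/

import Mathlib

/-- The permutation `(1,4,2,7)(5,6)(8,13,11,14)(12,15)` on `{0,…,15}`. -/
def permτ₁ : Equiv.Perm (Fin 16) :=
  ([1,4,2,7] : List (Fin 16)).formPerm * ([5,6] : List (Fin 16)).formPerm *
    ([8,13,11,14] : List (Fin 16)).formPerm * ([12,15] : List (Fin 16)).formPerm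

/-- The permutation `(1,6)(2,14)(3,8)(4,15)(5,9)(10,13)` on `{0,…,15}`. -/
def permτ₂ : Equiv.Perm (Fin 16) :=
  ([1,6] : List (Fin 16)).formPerm * ([2,14] : List (Fin 16)).formPerm *
    ([3,8] : List (Fin 16)).formPerm * ([4,15] : List (Fin 16)).formPerm *
    ([5,9] : List (Fin 16)).formPerm * ([10,13] : List (Fin 16)).formPerm

open Equiv MulAction
open scoped Pointwise

/-- The even permutation `(0,2,5,7)(1,4,3,6)` on `{0,…,7}`, the counterpart of `permτ₁`. -/
def permσ₁ : Perm (Fin 8) :=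
  ([0,2,5,7] : List (Fin 8)).formPerm * ([1,4,3,6] : List (Fin 8)).formPerm

/-- The even permutation `(0,1)(2,3)` on `{0,…,7}`, the counterpart of `permτ₂`. -/
def permσ₂ : Perm (Fin 8) :=
  ([0,1] : List (Fin 8)).formPerm * ([2,3] : List (Fin 8)).formPerm

theorem closure_permσ_pair_le : Subgroup.closure {permσ₁, permσ₂} ≤ alternatingGroup (Fin 8) := by
  rw [Subgroup.closure_le]
  rintro _ (rfl | rfl) <;> exact Perm.mem_alternatingGroup.2 (by decide +kernel)

theorem isPreprimitive_closure_permσ_pair :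
    IsPreprimitive (Subgroup.closure {permσ₁, permσ₂}) (Fin 8) := by
  set H := Subgroup.closure {permσ₁, permσ₂}
  have h₁ : permσ₁ ∈ H := Subgroup.subset_closure (by simp)
  have h₂ : permσ₂ ∈ H := Subgroup.subset_closure (by simp)
  -- `z` is a 7-cycle that fixes `0`
  let z := permσ₂ * permσ₁ ^ 2 * permσ₂ * permσ₁
  have hz : z ∈ H := mul_mem (mul_mem (mul_mem h₂ (pow_mem h₁ 2)) h₂) h₁
  have key : ∀ x y : Fin 8, x ≠ y → ∃ g ∈ H, g 0 = x ∧ g 1 = y := by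
    intro x y hxy
    have cover : ∀ x y : Fin 8, x ≠ y → ∃ (i : Fin 4) (j : Fin 2) (k : Fin 4) (l : Fin 7),
        (permσ₁ ^ i.val * permσ₂ ^ j.val * permσ₁ ^ k.val * z ^ l.val) 0 = x ∧
        (permσ₁ ^ i.val * permσ₂ ^ j.val * permσ₁ ^ k.val * z ^ l.val) 1 = y := by
      decide +kernel
    obtain ⟨i, j, k, l, h⟩ := cover x y hxy
    exact ⟨_, mul_mem (mul_mem (mul_mem (pow_mem h₁ _) (pow_mem h₂ _)) (pow_mem h₁ _))
      (pow_mem hz _), h⟩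
  apply isPreprimitive_of_is_two_pretransitive
  rw [is_two_pretransitive_iff]
  intro a b c d hab hcd
  obtain ⟨g, hg, rfl, rfl⟩ := key a b hab
  obtain ⟨g', hg', rfl, rfl⟩ := key c d hcd
  exact ⟨⟨g' * g⁻¹, mul_mem hg' (inv_mem hg)⟩, by simp [Subgroup.smul_def],
    by simp [Subgroup.smul_def]⟩

theorem closure_permσ_pair : Subgroup.closure {permσ₁, permσ₂} = alternatingGroup (Fin 8) := by
  refine closure_permσ_pair_le.antisymm ?_
  have h₁ : permσ₁ ∈ Subgroup.closure {permσ₁, permσ₂} := Subgroup.subset_closure (by simp)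
  have h₂ : permσ₂ ∈ Subgroup.closure {permσ₁, permσ₂} := Subgroup.subset_closure (by simp)
  have h_three : swap (2 : Fin 8) 4 * swap 2 3 = (permσ₂ * permσ₁ * permσ₂ * permσ₁ ^ 3) ^ 2 := by
    decide +kernel
  refine Perm.alternatingGroup_le_of_isPreprimitive_of_isThreeCycle_mem
    isPreprimitive_closure_permσ_pair
    (Perm.isThreeCycle_swap_mul_swap_same (a := 2) (b := 4) (c := 3)
      (by decide) (by decide) (by decide)) ?_
  rw [h_three]
  exact pow_mem (mul_mem (mul_mem (mul_mem h₂ h₁) h₂) (pow_mem h₁ 3)) 2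

/-- For `x ≠ 0`, a labelling of `{0,…,7}` by the vectors of `𝔽₂³`, encoded in binary; the
labelling attached to `0` is a dummy. -/
def affineLabel : Fin 16 → Fin 8 → ℕ :=
  ![![0, 0, 0, 0, 0, 0, 0, 0],
    ![0, 1, 2, 4, 7, 3, 6, 5],
    ![0, 1, 2, 4, 5, 7, 6, 3],
    ![0, 1, 2, 4, 3, 5, 6, 7],
    ![0, 1, 2, 4, 7, 6, 5, 3],
    ![0, 1, 2, 4, 7, 5, 3, 6],
    ![0, 1, 2, 4, 6, 5, 7, 3],
    ![0, 1, 2, 3, 4, 6, 5, 7],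
    ![0, 1, 2, 4, 5, 3, 7, 6],
    ![0, 1, 2, 4, 6, 3, 5, 7],
    ![0, 1, 2, 4, 5, 6, 3, 7],
    ![0, 1, 2, 3, 4, 5, 7, 6],
    ![0, 1, 2, 3, 4, 7, 6, 5],
    ![0, 1, 2, 4, 3, 7, 5, 6],
    ![0, 1, 2, 4, 3, 6, 7, 5],
    ![0, 1, 2, 4, 6, 7, 3, 5]]

/-- The planes of the affine structure on `{0,…,7}` given by `affineLabel x`: the 4-subsets whose
labels add up to zero. These are the 15 affine structures in one `A₈`-orbit, plus, at `x = 0`,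
the set of all 4-subsets. -/
def affinePlanes (x : Fin 16) : Finset (Finset (Fin 8)) :=
  (Finset.univ.powersetCard 4).filter fun s => s.fold (fun m n : ℕ => m ^^^ n) 0 (affineLabel x) = 0

theorem affinePlanes_injective : Function.Injective affinePlanes := by
  have h : ∀ x y, affinePlanes x = affinePlanes y → x = y := by decide +kernel
  exact fun x y => h x y

theorem affinePlanes_permτ₁ : ∀ x, affinePlanes (permτ₁ x) = permσ₁ • affinePlanes x := by
  decide +kernel

theorem affinePlanes_permτ₂ : ∀ x, affinePlanes (permτ₂ x) = permσ₂ • affinePlanes x := by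
  decide +kernel

/-- The subgroup of `Perm (Fin 16) × Perm (Fin 8)` generated by the pairs `(permτᵢ, permσᵢ)`; it
turns out to be the graph of an isomorphism. -/
def pairedSubgroup : Subgroup (Perm (Fin 16) × Perm (Fin 8)) :=
  Subgroup.closure {(permτ₁, permσ₁), (permτ₂, permσ₂)}

theorem affinePlanes_of_mem_pairedSubgroup {p : Perm (Fin 16) × Perm (Fin 8)}
    (hp : p ∈ pairedSubgroup) (x : Fin 16) : affinePlanes (p.1 x) = p.2 • affinePlanes x := by
  induction hp using Subgroup.closure_induction generalizing x with
  | mem p hp =>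
    rcases hp with rfl | rfl
    · exact affinePlanes_permτ₁ x
    · exact affinePlanes_permτ₂ x
  | one => simp
  | mul p q _ _ hp hq => simp [hp, hq, mul_smul]
  | inv p _ hp =>
    rw [Prod.snd_inv, eq_inv_smul_iff, ← hp]
    simp

theorem range_fst_pairedSubgroup :
    ((MonoidHom.fst _ _).comp pairedSubgroup.subtype).range =
      Subgroup.closure {permτ₁, permτ₂} := by
  rw [MonoidHom.range_comp, Subgroup.range_subtype, pairedSubgroup, MonoidHom.map_closure,
    Set.image_pair]
  rfl

theorem range_snd_pairedSubgroup :
    ((MonoidHom.snd _ _).comp pairedSubgroup.subtype).range = alternatingGroup (Fin 8) := by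
  rw [MonoidHom.range_comp, Subgroup.range_subtype, pairedSubgroup, MonoidHom.map_closure,
    Set.image_pair, ← closure_permσ_pair]
  rfl

theorem snd_pairedSubgroup_injective :
    Function.Injective ((MonoidHom.snd _ _).comp pairedSubgroup.subtype) := by
  rw [injective_iff_map_eq_one]
  rintro ⟨⟨g, h⟩, hp⟩ (rfl : h = 1)
  have hg : g = 1 := Perm.ext fun x =>
    affinePlanes_injective (by simpa using affinePlanes_of_mem_pairedSubgroup hp x)
  subst hg
  rfl

/-- The second projection identifies `pairedSubgroup` with `A₈`. -/
noncomputable def pairedSubgroupEquiv : pairedSubgroup ≃* alternatingGroup (Fin 8) :=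
  (MonoidHom.ofInjective snd_pairedSubgroup_injective).trans
    (MulEquiv.subgroupCongr range_snd_pairedSubgroup)

theorem fst_pairedSubgroup_injective :
    Function.Injective ((MonoidHom.fst _ _).comp pairedSubgroup.subtype) := by
  have : IsSimpleGroup (alternatingGroup (Fin 8)) := alternatingGroup.isSimpleGroup (by simp)
  have : IsSimpleGroup pairedSubgroup := pairedSubgroupEquiv.isSimpleGroup
  rw [← MonoidHom.ker_eq_bot_iff]
  refine (MonoidHom.normal_ker _).eq_bot_or_eq_top.resolve_right fun h => ?_
  have hmem : (⟨(permτ₁, permσ₁), Subgroup.subset_closure (by simp)⟩ : pairedSubgroup) ∈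
      ((MonoidHom.fst _ _).comp pairedSubgroup.subtype).ker := h ▸ Subgroup.mem_top _
  have hone : permτ₁ = 1 := hmem
  exact absurd (DFunLike.congr_fun hone 1) (by decide +kernel)

theorem stmt_17 :
    Nonempty ((Subgroup.closure {permτ₁, permτ₂} : Subgroup (Equiv.Perm (Fin 16))) ≃*
      alternatingGroup (Fin 8)) := by
  exact ⟨((MonoidHom.ofInjective fst_pairedSubgroup_injective).trans
    (MulEquiv.subgroupCongr range_fst_pairedSubgroup)).symm.trans pairedSubgroupEquiv⟩
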